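/- Telescoping lemma in the endogenous state space (Lemma 1): Let M = (S, A, T, r, μ₀, γ) and M̃ = (S, A, T̃, r, μ₀, γ) be two finite discounted MDPs with the same state space, action space, reward function, initial distribution and discount factor, but different dynamics T and T̃. Then for every stationary stochastic policy π : S → PMF(A), η_M̃(π) − η_M(π) = γ · Ē_{(s,a)∼ρ_{T̃}^π}[G_M̃^π(s, a)]. -/

import Mathlib

open scoped BigOperators

/-- Expectation of a real-valued function under a `PMF` on a finite type. -/
noncomputable def pmfExp {X : Type*} [Fintype X] (d : PMF X) (f : X → ℝ) : ℝ :=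
  ∑ x, (d x).toReal * f x

/-- Initial state–action distribution: `s ∼ μ`, `a ∼ π s`. -/
noncomputable def initSA {S A : Type*} (π : S → PMF A) (μ : PMF S) : PMF (S × A) :=
  μ.bind fun s => (π s).map fun a => (s, a)

/-- One step of the state–action Markov chain induced by dynamics `T` and policy `π`. -/
noncomputable def stepSA {S A : Type*} (T : S → A → PMF S) (π : S → PMF A)
    (d : PMF (S × A)) : PMF (S × A) :=
  d.bind fun sa => (T sa.1 sa.2).bind fun s' => (π s').map fun a' => (s', a')

/-- Distribution of the time-`t` state–action pair of the chain started from `μ`. -/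
noncomputable def saDist {S A : Type*} (T : S → A → PMF S) (π : S → PMF A)
    (μ : PMF S) : ℕ → PMF (S × A)
  | 0 => initSA π μ
  | (t + 1) => stepSA T π (saDist T π μ t)

/-- Unnormalized discounted occupancy expectation
`Ē_{(s,a)∼ρ_T^π}[f] = Σ_t γ^t E[f(s_t,a_t)]`, chain started from `μ`. -/
noncomputable def occExp {S A : Type*} [Fintype S] [Fintype A]
    (T : S → A → PMF S) (π : S → PMF A) (μ : PMF S) (γ : ℝ) (f : S × A → ℝ) : ℝ :=
  ∑' t : ℕ, γ ^ t * pmfExp (saDist T π μ t) f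

/-- Value function `V_M^π(s)` of the MDP with dynamics `T`, reward `r`, discount `γ`. -/
noncomputable def valueFun {S A : Type*} [Fintype S] [Fintype A]
    (T : S → A → PMF S) (π : S → PMF A) (r : S × A → ℝ) (γ : ℝ) (s : S) : ℝ :=
  occExp T π (PMF.pure s) γ r

/-- Expected return `η_M(π) = E_{s∼μ₀}[V_M^π(s)]`. -/
noncomputable def expReturn {S A : Type*} [Fintype S] [Fintype A]
    (T : S → A → PMF S) (π : S → PMF A) (r : S × A → ℝ) (γ : ℝ) (μ : PMF S) : ℝ :=
  ∑ s, (μ s).toReal * valueFun T π r γ s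

/-- Model-error gap `G_{M̃}^π(s,a) = E_{s'∼T̃(s,a)}[V_M^π(s')] − E_{s'∼T(s,a)}[V_M^π(s')]`,
where `T` is the true dynamics and `T'` the model dynamics. -/
noncomputable def Ggap {S A : Type*} [Fintype S] [Fintype A]
    (T T' : S → A → PMF S) (π : S → PMF A) (r : S × A → ℝ) (γ : ℝ) (sa : S × A) : ℝ :=
  (∑ s', ((T' sa.1 sa.2) s').toReal * valueFun T π r γ s') -
    (∑ s', ((T sa.1 sa.2) s').toReal * valueFun T π r γ s')

section PMFExp

variable {X Y : Type*} [Fintype X] [Fintype Y]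

theorem pmfExp_pure (x : X) (f : X → ℝ) : pmfExp (PMF.pure x) f = f x := by
  classical
  simp [pmfExp, PMF.pure_apply, apply_ite ENNReal.toReal]

theorem pmfExp_bind (d : PMF X) (g : X → PMF Y) (f : Y → ℝ) :
    pmfExp (d.bind g) f = pmfExp d fun x => pmfExp (g x) f := by
  have h (y : Y) : (d.bind g y).toReal = ∑ x, (d x).toReal * (g x y).toReal := by
    rw [PMF.bind_apply, tsum_fintype, ENNReal.toReal_sum fun x _ =>
      ENNReal.mul_ne_top (d.apply_ne_top x) ((g x).apply_ne_top y)]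
    simp only [ENNReal.toReal_mul]
  simp only [pmfExp, h, Finset.sum_mul, Finset.mul_sum, mul_assoc]
  exact Finset.sum_comm

theorem pmfExp_map (d : PMF X) (g : X → Y) (f : Y → ℝ) :
    pmfExp (d.map g) f = pmfExp d fun x => f (g x) := by
  rw [← PMF.bind_pure_comp, pmfExp_bind]
  simp only [Function.comp_apply, pmfExp_pure]

theorem pmfExp_add (d : PMF X) (f g : X → ℝ) :
    pmfExp d (fun x => f x + g x) = pmfExp d f + pmfExp d g := by
  simp only [pmfExp, mul_add, Finset.sum_add_distrib]

theorem pmfExp_const_mul (d : PMF X) (c : ℝ) (f : X → ℝ) :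
    pmfExp d (fun x => c * f x) = c * pmfExp d f := by
  simp only [pmfExp, Finset.mul_sum, mul_left_comm]

theorem abs_pmfExp_le (d : PMF X) (f : X → ℝ) : |pmfExp d f| ≤ ∑ x, |f x| := by
  refine (Finset.abs_sum_le_sum_abs _ _).trans (Finset.sum_le_sum fun x _ => ?_)
  rw [abs_mul, abs_of_nonneg ENNReal.toReal_nonneg]
  exact mul_le_of_le_one_left (abs_nonneg _)
    (ENNReal.toReal_le_of_le_ofReal zero_le_one (by simpa using d.coe_le_one x))

end PMFExp

section Chain

variable {S A : Type*} (T : S → A → PMF S) (π : S → PMF A)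

theorem saDist_eq_bind (μ : PMF S) (t : ℕ) :
    saDist T π μ t = μ.bind fun s => saDist T π (PMF.pure s) t := by
  induction t with
  | zero => simp only [saDist, initSA, PMF.pure_bind]
  | succ t ih =>
    simp only [saDist]
    rw [ih]
    simp only [stepSA, PMF.bind_bind]

/-- Running the chain for `t + 1` steps is running it for `t` steps from the law of `s₁`. -/
theorem saDist_succ_eq (μ : PMF S) (t : ℕ) :
    saDist T π μ (t + 1) =
      saDist T π ((initSA π μ).bind fun sa => T sa.1 sa.2) t := by
  induction t with
  | zero => simp only [saDist, stepSA, initSA, PMF.bind_bind]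
  | succ t ih => rw [saDist, ih, saDist]

variable [Fintype S] [Fintype A]

theorem pmfExp_initSA (μ : PMF S) (f : S × A → ℝ) :
    pmfExp (initSA π μ) f = pmfExp μ fun s => pmfExp (π s) fun a => f (s, a) := by
  simp only [initSA, pmfExp_bind, pmfExp_map]

theorem pmfExp_stepSA (d : PMF (S × A)) (f : S × A → ℝ) :
    pmfExp (stepSA T π d) f = pmfExp d fun sa => pmfExp (T sa.1 sa.2) fun s' =>
      pmfExp (π s') fun a' => f (s', a') := by
  simp only [stepSA, pmfExp_bind, pmfExp_map]

theorem summable_occExp {γ : ℝ} (hγ0 : 0 ≤ γ) (hγ1 : γ < 1) (μ : PMF S) (f : S × A → ℝ) :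
    Summable fun t : ℕ => γ ^ t * pmfExp (saDist T π μ t) f := by
  refine Summable.of_norm_bounded
    ((summable_geometric_of_lt_one hγ0 hγ1).mul_right (∑ x, |f x|)) fun t => ?_
  rw [Real.norm_eq_abs, abs_mul, abs_of_nonneg (pow_nonneg hγ0 t)]
  exact mul_le_mul_of_nonneg_left (abs_pmfExp_le _ _) (pow_nonneg hγ0 t)

theorem occExp_add {γ : ℝ} (hγ0 : 0 ≤ γ) (hγ1 : γ < 1) (μ : PMF S) (f g : S × A → ℝ) :
    occExp T π μ γ (fun sa => f sa + g sa) = occExp T π μ γ f + occExp T π μ γ g := by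
  simp only [occExp, pmfExp_add, mul_add]
  exact (summable_occExp T π hγ0 hγ1 μ f).tsum_add (summable_occExp T π hγ0 hγ1 μ g)

theorem occExp_const_mul {γ : ℝ} (μ : PMF S) (c : ℝ) (f : S × A → ℝ) :
    occExp T π μ γ (fun sa => c * f sa) = c * occExp T π μ γ f := by
  simp only [occExp, pmfExp_const_mul, mul_left_comm _ c, tsum_mul_left]

theorem expReturn_eq_occExp {γ : ℝ} (hγ0 : 0 ≤ γ) (hγ1 : γ < 1) (r : S × A → ℝ) (μ : PMF S) :
    expReturn T π r γ μ = occExp T π μ γ r := by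
  simp only [expReturn, valueFun, occExp, ← tsum_mul_left]
  rw [← Summable.tsum_finsetSum fun s _ =>
    (summable_occExp T π hγ0 hγ1 (PMF.pure s) r).mul_left _]
  refine tsum_congr fun t => ?_
  rw [saDist_eq_bind T π μ t, pmfExp_bind]
  simp only [pmfExp, Finset.mul_sum, mul_left_comm]

/-- Shifting time by one inside the integrand. -/
theorem occExp_eq_init_add {γ : ℝ} (hγ0 : 0 ≤ γ) (hγ1 : γ < 1) (μ : PMF S)
    (f : S × A → ℝ) :
    occExp T π μ γ f = pmfExp (initSA π μ) f +
      γ * occExp T π μ γ fun sa => pmfExp (T sa.1 sa.2) fun s' =>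
        pmfExp (π s') fun a' => f (s', a') := by
  rw [occExp, (summable_occExp T π hγ0 hγ1 μ f).tsum_eq_zero_add]
  simp only [occExp, ← tsum_mul_left, pow_zero, one_mul, saDist, pmfExp_stepSA, pow_succ',
    mul_assoc]

/-- Shifting time by one in the initial distribution. -/
theorem occExp_eq_init_add_occExp {γ : ℝ} (hγ0 : 0 ≤ γ) (hγ1 : γ < 1) (μ : PMF S)
    (f : S × A → ℝ) :
    occExp T π μ γ f = pmfExp (initSA π μ) f +
      γ * occExp T π ((initSA π μ).bind fun sa => T sa.1 sa.2) γ f := by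
  rw [occExp, (summable_occExp T π hγ0 hγ1 μ f).tsum_eq_zero_add]
  simp only [saDist_succ_eq]
  simp only [occExp, ← tsum_mul_left, pow_zero, one_mul, saDist, pow_succ', mul_assoc]

/-- The Bellman equation. -/
theorem valueFun_eq {γ : ℝ} (hγ0 : 0 ≤ γ) (hγ1 : γ < 1) (r : S × A → ℝ) (s : S) :
    valueFun T π r γ s = pmfExp (π s) fun a =>
      r (s, a) + γ * pmfExp (T s a) (valueFun T π r γ) := by
  rw [valueFun, occExp_eq_init_add_occExp T π hγ0 hγ1,
    ← expReturn_eq_occExp T π hγ0 hγ1]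
  change _ + γ * pmfExp _ (valueFun T π r γ) = _
  rw [pmfExp_bind, pmfExp_initSA, pmfExp_initSA, pmfExp_pure, pmfExp_pure, pmfExp_add,
    pmfExp_const_mul]

end Chain

/-- **Telescoping lemma in the endogenous state space (Lemma 1).**
For MDPs `M = (S,A,T,r,μ₀,γ)` and `M̃ = (S,A,T',r,μ₀,γ)` differing only in dynamics,
`η_{M̃}(π) − η_M(π) = γ · Ē_{(s,a)∼ρ_{T̃}^π}[G_{M̃}^π(s,a)]`. -/
theorem telescoping_lemma_endogenous
    {S A : Type*} [Fintype S] [Fintype A] [Nonempty S] [Nonempty A]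
    (T T' : S → A → PMF S) (r : S × A → ℝ) (μ₀ : PMF S) (γ : ℝ)
    (hγ0 : 0 ≤ γ) (hγ1 : γ < 1) (π : S → PMF A) :
    expReturn T' π r γ μ₀ - expReturn T π r γ μ₀ =
      γ * occExp T' π μ₀ γ (fun sa => Ggap T T' π r γ sa) := by
  set V := valueFun T π r γ with hV
  have bellman (s : S) :
      pmfExp (π s) (fun a => r (s, a) + γ * pmfExp (T s a) V) = V s :=
    (valueFun_eq T π hγ0 hγ1 r s).symm
  have hr := expReturn_eq_occExp T' π hγ0 hγ1 r μ₀
  have hη : expReturn T π r γ μ₀ = pmfExp μ₀ V := rfl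
  have hG : occExp T' π μ₀ γ (fun sa => pmfExp (T' sa.1 sa.2) V) =
      occExp T' π μ₀ γ (fun sa => Ggap T T' π r γ sa) +
        occExp T' π μ₀ γ (fun sa => pmfExp (T sa.1 sa.2) V) := by
    rw [← occExp_add T' π hγ0 hγ1]
    congr 1
    funext sa
    simp only [Ggap, pmfExp, ← hV, sub_add_cancel]
  have hQ := occExp_eq_init_add T' π hγ0 hγ1 μ₀
    fun sa => r sa + γ * pmfExp (T sa.1 sa.2) V
  rw [pmfExp_initSA, occExp_add T' π hγ0 hγ1, occExp_const_mul] at hQ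
  simp only [bellman] at hQ
  rw [hr, hη]
  linear_combination hQ + γ * hG
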